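/- arXiv:2404.01823 — 4 statements merged into one kernel-verified Lean document; each statement's English description precedes it below -/
import Mathlib

section
/- Let V be a real Banach space, let A : V → (V →L[ℝ] ℝ) and J : V → ℝ be three times continuously Fréchet differentiable, let U, Z, Ũ, Z̃ ∈ V with e := U − Ũ and f := Z − Z̃, and suppose A(U) = 0 in V* and (A′(U)ψ)(Z) = J′(U)(ψ) for all ψ ∈ V. Then the function F : ℝ → ℝ defined by F(s) := J(Ũ + s·e) − A(Ũ + s·e)(Z̃ + s·f) satisfies F(0) = J(Ũ) − A(Ũ)(Z̃), F(1) = J(U), F′(0) = J′(Ũ)(e) − (A′(Ũ)e)(Z̃) − A(Ũ)(f), and F′(1) = 0. -/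
/-- Derivative along a line of the Lagrangian `(u, z) ↦ J u - A u z`. -/
theorem hasDerivAt_lagrangian_along_line
    {V : Type*} [NormedAddCommGroup V] [NormedSpace ℝ V]
    {A : V → (V →L[ℝ] ℝ)} {J : V → ℝ} (u z e f : V) (s : ℝ)
    (hA : DifferentiableAt ℝ A (u + s • e)) (hJ : DifferentiableAt ℝ J (u + s • e)) :
    HasDerivAt (fun t : ℝ => J (u + t • e) - A (u + t • e) (z + t • f))
      (fderiv ℝ J (u + s • e) e -
        ((fderiv ℝ A (u + s • e) e) (z + s • f) + A (u + s • e) f)) s := by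
  have line (x v : V) : HasDerivAt (fun t : ℝ => x + t • v) v s := by
    simpa using ((hasDerivAt_id s).smul_const v).const_add x
  have hJ' : HasDerivAt (fun t : ℝ => J (u + t • e)) (fderiv ℝ J (u + s • e) e) s :=
    hJ.hasFDerivAt.comp_hasDerivAt s (line u e)
  have hA' : HasDerivAt (fun t : ℝ => A (u + t • e)) (fderiv ℝ A (u + s • e) e) s :=
    hA.hasFDerivAt.comp_hasDerivAt s (line u e)
  exact hJ'.fun_sub (hA'.clm_apply (line z f))

/-- Endpoint values and derivatives of the interpolating function used in the proof of
the DWR error representation. -/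
theorem dwr_interpolating_function_endpoints
    {V : Type*} [NormedAddCommGroup V] [NormedSpace ℝ V] [CompleteSpace V]
    (A : V → (V →L[ℝ] ℝ)) (J : V → ℝ)
    (hA : ContDiff ℝ 3 A) (hJ : ContDiff ℝ 3 J)
    (U Z Ut Zt : V)
    (hU : A U = 0)
    (hadj : ∀ ψ : V, (fderiv ℝ A U ψ) Z = fderiv ℝ J U ψ)
    (e f : V) (he : e = U - Ut) (hf : f = Z - Zt)
    (F : ℝ → ℝ)
    (hFdef : F = fun s : ℝ => J (Ut + s • e) - A (Ut + s • e) (Zt + s • f)) :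
    F 0 = J Ut - A Ut Zt ∧
    F 1 = J U ∧
    deriv F 0 = fderiv ℝ J Ut e - (fderiv ℝ A Ut e) Zt - A Ut f ∧
    deriv F 1 = 0 := by
  subst he hf hFdef
  have hderiv (s : ℝ) := (hasDerivAt_lagrangian_along_line Ut Zt (U - Ut) (Z - Zt) s
    (hA.differentiable (by norm_num)).differentiableAt
    (hJ.differentiable (by norm_num)).differentiableAt).deriv
  refine ⟨by simp, by simp [hU], ?_, ?_⟩
  · rw [hderiv 0]
    simp only [zero_smul, add_zero]
    ring
  · rw [hderiv 1]
    simp only [one_smul, add_sub_cancel, hU, hadj, zero_apply, add_zero,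
      sub_self]
end

section
/- DWR error representation with explicit remainder: Let V be a real Banach space, and let A : V → (V →L[ℝ] ℝ) and J : V → ℝ be three times continuously Fréchet differentiable. Suppose U ∈ V satisfies A(U) = 0 in V*, and Z ∈ V satisfies (A′(U)ψ)(Z) = J′(U)(ψ) for all ψ ∈ V. Then for all Ũ, Z̃ ∈ V, writing e := U − Ũ and f := Z − Z̃, one has J(U) − J(Ũ) = (1/2)·( −A(Ũ)(f) + J′(Ũ)(e) − (A′(Ũ)e)(Z̃) ) − A(Ũ)(Z̃) + R, where R = (1/2)·∫₀¹ s·(s−1)·[ J‴(Ũ+s·e)(e,e,e) − (A‴(Ũ+s·e)(e,e,e))(Z̃+s·f) − 3·(A″(Ũ+s·e)(e,e))(f) ] ds, and A″, A‴, J″, J‴ denote the second and third iterated Fréchet derivatives (symmetric continuous multilinear maps). -/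
/-- The error of the trapezoidal rule for `∫₀¹ g' = g 1 - g 0`, in Peano kernel form. -/
theorem sub_eq_trapezoid_add_integral {g g₁ g₂ g₃ : ℝ → ℝ}
    (hg : ∀ s, HasDerivAt g (g₁ s) s) (hg₁ : ∀ s, HasDerivAt g₁ (g₂ s) s)
    (hg₂ : ∀ s, HasDerivAt g₂ (g₃ s) s) (hg₃ : Continuous g₃) :
    g 1 - g 0 = (1 / 2) * (g₁ 0 + g₁ 1) + (1 / 2) * ∫ s in (0:ℝ)..1, s * (s - 1) * g₃ s := by
  have key : ∀ s ∈ Set.uIcc (0:ℝ) 1,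
      HasDerivAt (fun s => s * (s - 1) * g₂ s - (2 * s - 1) * g₁ s + 2 * g s)
        (s * (s - 1) * g₃ s) s := by
    intro s _
    have hid := hasDerivAt_id' s
    refine ((((hid.mul (hid.sub_const 1)).mul (hg₂ s)).sub
      (((hid.const_mul 2).sub_const 1).mul (hg₁ s))).add ((hg s).const_mul 2)).congr_deriv ?_
    simp only [Pi.mul_apply]
    ring
  rw [intervalIntegral.integral_eq_sub_of_hasDerivAt key
    (Continuous.intervalIntegrable (by fun_prop) _ _)]
  ring

/-- Along a line, the `n`-th directional derivative has the `(n + 1)`-st one as derivative. -/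
theorem ContDiff.hasDerivAt_iteratedFDeriv_add_smul {E F : Type*}
    [NormedAddCommGroup E] [NormedSpace ℝ E] [NormedAddCommGroup F] [NormedSpace ℝ F]
    {f : E → F} {N : WithTop ℕ∞} {n : ℕ} (hf : ContDiff ℝ N f) (hn : n < N) (x v : E) (s : ℝ) :
    HasDerivAt (fun t : ℝ => iteratedFDeriv ℝ n f (x + t • v) fun _ => v)
      (iteratedFDeriv ℝ (n + 1) f (x + s • v) fun _ => v) s := by
  have hline : HasDerivAt (fun t : ℝ => x + t • v) v s := by
    simpa using ((hasDerivAt_id' s).smul_const v).const_add x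
  exact ((hf.differentiable_iteratedFDeriv hn
    (x + s • v)).hasFDerivAt.continuousMultilinear_apply_const fun _ => v).comp_hasDerivAt s hline

/-- DWR error representation with explicit remainder. -/
theorem dwr_error_representation
    {V : Type*} [NormedAddCommGroup V] [NormedSpace ℝ V] [CompleteSpace V]
    (A : V → (V →L[ℝ] ℝ)) (J : V → ℝ)
    (hA : ContDiff ℝ 3 A) (hJ : ContDiff ℝ 3 J)
    (U Z : V)
    (hU : A U = 0)
    (hadj : ∀ ψ : V, (fderiv ℝ A U ψ) Z = fderiv ℝ J U ψ) :
    ∀ Ut Zt : V,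
      J U - J Ut =
        (1 / 2) * (-(A Ut (Z - Zt)) + fderiv ℝ J Ut (U - Ut)
            - (fderiv ℝ A Ut (U - Ut)) Zt)
          - A Ut Zt
          + (1 / 2) * ∫ s in (0:ℝ)..1, s * (s - 1) *
              (iteratedFDeriv ℝ 3 J (Ut + s • (U - Ut)) ![U - Ut, U - Ut, U - Ut]
                - (iteratedFDeriv ℝ 3 A (Ut + s • (U - Ut)) ![U - Ut, U - Ut, U - Ut])
                    (Zt + s • (Z - Zt))
                - 3 * (iteratedFDeriv ℝ 2 A (Ut + s • (U - Ut)) ![U - Ut, U - Ut])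
                    (Z - Zt)) := by
  intro Ut Zt
  set e := U - Ut
  set f := Z - Zt
  have hvec₂ : (![e, e] : Fin 2 → V) = fun _ => e := by ext i; fin_cases i <;> rfl
  have hvec₃ : (![e, e, e] : Fin 3 → V) = fun _ => e := by ext i; fin_cases i <;> rfl
  rw [hvec₃, hvec₂]
  have hz (s : ℝ) : HasDerivAt (fun t : ℝ => Zt + t • f) f s := by
    simpa using ((hasDerivAt_id' s).smul_const f).const_add Zt
  let j (n : ℕ) (s : ℝ) : ℝ := iteratedFDeriv ℝ n J (Ut + s • e) fun _ => e
  let a (n : ℕ) (s : ℝ) : V →L[ℝ] ℝ := iteratedFDeriv ℝ n A (Ut + s • e) fun _ => e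
  have hj (n : ℕ) (hn : (n : WithTop ℕ∞) < 3) (s : ℝ) : HasDerivAt (j n) (j (n + 1) s) s :=
    hJ.hasDerivAt_iteratedFDeriv_add_smul hn Ut e s
  have ha (n : ℕ) (hn : (n : WithTop ℕ∞) < 3) (s : ℝ) : HasDerivAt (a n) (a (n + 1) s) s :=
    hA.hasDerivAt_iteratedFDeriv_add_smul hn Ut e s
  have h0 : ((0 : ℕ) : WithTop ℕ∞) < 3 := by norm_num
  have h1 : ((1 : ℕ) : WithTop ℕ∞) < 3 := by norm_num
  have h2 : ((2 : ℕ) : WithTop ℕ∞) < 3 := by norm_num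
  have hjc : Continuous (j 3) := by
    have := hJ.continuous_iteratedFDeriv (m := 3) le_rfl
    fun_prop
  have hac (n : ℕ) (hn : (n : WithTop ℕ∞) ≤ 3) : Continuous (a n) := by
    have := hA.continuous_iteratedFDeriv hn
    fun_prop
  have ha₂ := hac 2 h2.le
  have ha₃ := hac 3 le_rfl
  have key := sub_eq_trapezoid_add_integral
    (g := fun s => j 0 s - a 0 s (Zt + s • f))
    (g₁ := fun s => j 1 s - a 1 s (Zt + s • f) - a 0 s f)
    (g₂ := fun s => j 2 s - a 2 s (Zt + s • f) - 2 * a 1 s f)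
    (g₃ := fun s => j 3 s - a 3 s (Zt + s • f) - 3 * a 2 s f)
    (fun s => by
      refine ((hj 0 h0 s).sub ((ha 0 h0 s).clm_apply (hz s))).congr_deriv ?_
      ring)
    (fun s => by
      refine (((hj 1 h1 s).sub ((ha 1 h1 s).clm_apply (hz s))).sub
        ((ha 0 h0 s).clm_apply (hasDerivAt_const s f))).congr_deriv ?_
      simp only [map_zero]
      ring)
    (fun s => by
      refine (((hj 2 h2 s).sub ((ha 2 h2 s).clm_apply (hz s))).sub
        (((ha 1 h1 s).clm_apply (hasDerivAt_const s f)).const_mul 2)).congr_deriv ?_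
      simp only [map_zero]
      ring)
    (by fun_prop)
  have hU' : Ut + e = U := add_sub_cancel Ut U
  have hZ' : Zt + f = Z := add_sub_cancel Zt Z
  simp only [j, a, iteratedFDeriv_zero_apply, iteratedFDeriv_one_apply, zero_smul, add_zero,
    one_smul, hU', hZ', hU, hadj, zero_apply] at key
  have hAf : A Ut f = A Ut Z - A Ut Zt := map_sub _ _ _
  linarith
end

section
/- Efficiency and reliability of the discretization error estimator: Let E, D, η, η_h, r be real numbers with E = D + η and η = η_h + r. Suppose b ∈ (0,1) with |D| ≤ b·|E| and ξ ∈ (0,1) with |r| ≤ ξ·|η_h|. Then ((1 − ξ)/(1 + b))·|η_h| ≤ |E| ≤ ((1 + ξ)/(1 − b))·|η_h|. In particular the discretization error estimator η_h is efficient with constant (1−ξ)/(1+b) and reliable with constant (1+ξ)/(1−b). -/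
/-- Efficiency and reliability of the discretization error estimator `η_h`. -/
theorem discretization_estimator_efficient_and_reliable
    (E D η ηh r : ℝ) (hE : E = D + η) (hη : η = ηh + r)
    (b : ℝ) (hb : b ∈ Set.Ioo (0:ℝ) 1) (hD : |D| ≤ b * |E|)
    (ξ : ℝ) (hξ : ξ ∈ Set.Ioo (0:ℝ) 1) (hr : |r| ≤ ξ * |ηh|) :
    ((1 - ξ) / (1 + b)) * |ηh| ≤ |E| ∧ |E| ≤ ((1 + ξ) / (1 - b)) * |ηh| := by
  obtain ⟨hb0, hb1⟩ := hb
  have hsum : E = ηh + (D + r) := by rw [hE, hη]; ring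
  have hlower : |ηh| ≤ |E| + (|D| + |r|) := by
    calc |ηh| = |E - (D + r)| := by rw [hsum, add_sub_cancel_right]
      _ ≤ |E| + |D + r| := abs_sub _ _
      _ ≤ |E| + (|D| + |r|) := by gcongr; exact abs_add_le _ _
  have hupper : |E| ≤ |ηh| + (|D| + |r|) := by
    calc |E| = |ηh + (D + r)| := by rw [hsum]
      _ ≤ |ηh| + |D + r| := abs_add_le _ _
      _ ≤ |ηh| + (|D| + |r|) := by gcongr; exact abs_add_le _ _
  constructor
  · rw [div_mul_eq_mul_div, div_le_iff₀ (by linarith)]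
    linarith
  · rw [div_mul_eq_mul_div, le_div_iff₀ (by linarith)]
    linarith
end

section
/- Bounds on the effectivity index: Let E, D, η, η_h, r be real numbers with E = D + η, η = η_h + r, E ≠ 0, and suppose b ∈ (0,1) with |D| ≤ b·|E| and ξ ∈ (0,1) with |r| ≤ ξ·|η_h|. Then the effectivity index I_eff := |η_h| / |E| satisfies (1 − b)/(1 + ξ) ≤ I_eff ≤ (1 + b)/(1 − ξ). -/
/-- Bounds on the effectivity index `I_eff = |η_h| / |E|`. -/
theorem effectivity_index_bounds
    (E D η ηh r : ℝ) (hE : E = D + η) (hη : η = ηh + r) (hE0 : E ≠ 0)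
    (b : ℝ) (hb : b ∈ Set.Ioo (0:ℝ) 1) (hD : |D| ≤ b * |E|)
    (ξ : ℝ) (hξ : ξ ∈ Set.Ioo (0:ℝ) 1) (hr : |r| ≤ ξ * |ηh|) :
    (1 - b) / (1 + ξ) ≤ |ηh| / |E| ∧ |ηh| / |E| ≤ (1 + b) / (1 - ξ) := by
  obtain ⟨hξ0, hξ1⟩ := hξ
  have hEpos : 0 < |E| := abs_pos.mpr hE0
  have hE_le : |E| ≤ |D| + |ηh| + |r| := by
    rw [hE, hη, ← add_assoc]
    exact abs_add_three D ηh r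
  have hηh_le : |ηh| ≤ |E| + |D| + |r| := by
    have h : ηh = E + -D + -r := by linarith
    calc |ηh| = |E + -D + -r| := congrArg _ h
      _ ≤ |E| + |-D| + |-r| := abs_add_three _ _ _
      _ = |E| + |D| + |r| := by rw [abs_neg, abs_neg]
  constructor
  · rw [div_le_div_iff₀ (by linarith) hEpos]
    linarith
  · rw [div_le_div_iff₀ hEpos (by linarith)]
    linarith
end
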